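/- Let Γ be a set of purely propositional formulas (containing no occurrence of the modal operator L) built using only the connectives ⊕ (exclusive or) and the constant ⊤, let ψ be such a formula, and let Σ := Γ ∪ {Lψ}. Then the following are equivalent: (i) Γ ⊨ ψ; (ii) {Lψ} is a Σ-full set; (iii) Σ has a stable expansion. -/

import Mathlib

/-- Autoepistemic formulas: propositional variables, Boolean connectives
`⊤, ⊥, ¬, ∧, ∨, ⊕`, and the modal operator `L` (`box`). -/
inductive AE : Type
  | var : ℕ → AE
  | top : AE
  | bot : AE
  | neg : AE → AE
  | conj : AE → AE → AE
  | disj : AE → AE → AE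
  | xor : AE → AE → AE
  | box : AE → AE
  deriving DecidableEq

namespace AE

/-- Propositional evaluation of an autoepistemic formula, where `v` assigns
truth values to propositional variables and `w` assigns truth values to
`L`-prefixed formulas (which are treated as atoms). -/
def eval (v : ℕ → Bool) (w : AE → Bool) : AE → Bool
  | var n => v n
  | top => true
  | bot => false
  | neg φ => !(eval v w φ)
  | conj φ ψ => eval v w φ && eval v w ψ
  | disj φ ψ => eval v w φ || eval v w ψ
  | xor φ ψ => (eval v w φ) != (eval v w ψ)
  | box φ => w φ

/-- Propositional consequence, treating `L`-prefixed formulas as atoms. -/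
def entails (S : Set AE) (φ : AE) : Prop :=
  ∀ v w, (∀ ψ ∈ S, eval v w ψ = true) → eval v w φ = true

/-- Deductive closure. -/
def Th (S : Set AE) : Set AE := {φ | entails S φ}

/-- `Δ` is a stable expansion of `S` if `Δ = Th (S ∪ L(Δ) ∪ ¬L(Δᶜ))`. -/
def IsStableExpansion (S Δ : Set AE) : Prop :=
  Δ = Th (S ∪ (box '' Δ) ∪ ((fun φ => neg (box φ)) '' Δᶜ))

/-- The set of subformulas of a formula (including the formula itself). -/
def subf : AE → Set AE
  | var n => {var n}
  | top => {top}
  | bot => {bot}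
  | neg φ => insert (neg φ) (subf φ)
  | conj φ ψ => insert (conj φ ψ) (subf φ ∪ subf ψ)
  | disj φ ψ => insert (disj φ ψ) (subf φ ∪ subf ψ)
  | xor φ ψ => insert (xor φ ψ) (subf φ ∪ subf ψ)
  | box φ => insert (box φ) (subf φ)

/-- `SF^L(S)`: the `L`-prefixed subformulas of formulas in `S`. -/
def SFL (S : Set AE) : Set AE := {χ | (∃ φ ∈ S, χ ∈ subf φ) ∧ ∃ ψ, χ = box ψ}

/-- `¬SF^L(S)`. -/
def negSFL (S : Set AE) : Set AE := neg '' SFL S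

/-- `Λ` is an `S`-full set. -/
def IsFull (S Λ : Set AE) : Prop :=
  Λ ⊆ SFL S ∪ negSFL S ∧
  ∀ φ, box φ ∈ SFL S →
    (entails (S ∪ Λ) φ ↔ box φ ∈ Λ) ∧ (¬ entails (S ∪ Λ) φ ↔ neg (box φ) ∈ Λ)


/-- Purely propositional formulas built using only `⊕` and `⊤`
(no occurrence of the modal operator `L`). -/
def IsPropXorTop : AE → Prop
  | var _ => True
  | top => True
  | xor φ ψ => IsPropXorTop φ ∧ IsPropXorTop ψ
  | _ => False

/-- A purely propositional formula has the same value under all valuations of the modal atoms. -/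
theorem IsPropXorTop.eval_congr {φ : AE} (h : IsPropXorTop φ) (v : ℕ → Bool) (w w' : AE → Bool) :
    eval v w φ = eval v w' φ := by
  induction φ with
  | xor φ ψ ihφ ihψ => simp only [eval, ihφ h.1, ihψ h.2]
  | _ => first | rfl | exact h.elim

/-- A purely propositional formula has no `L`-prefixed subformulas. -/
theorem IsPropXorTop.box_notMem_subf {φ : AE} (h : IsPropXorTop φ) (χ : AE) :
    box χ ∉ subf φ := by
  induction φ with
  | xor φ ψ ihφ ihψ => simp [subf, ihφ h.1, ihψ h.2]
  | _ => first | exact h.elim | simp [subf]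

theorem box_mem_SFL_iff {Γ : Set AE} {ψ : AE} (hΓ : ∀ φ ∈ Γ, IsPropXorTop φ)
    (hψ : IsPropXorTop ψ) (χ : AE) : box χ ∈ SFL (Γ ∪ {box ψ}) ↔ χ = ψ := by
  constructor
  · rintro ⟨⟨φ, hφ | rfl, hχ⟩, -⟩
    · exact absurd hχ ((hΓ φ hφ).box_notMem_subf χ)
    · rcases hχ with hχ | hχ
      · exact box.inj hχ
      · exact absurd hχ (hψ.box_notMem_subf χ)
  · rintro rfl
    exact ⟨⟨box χ, Or.inr rfl, Or.inl rfl⟩, χ, rfl⟩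

theorem entails.mono {S T : Set AE} {φ : AE} (h : entails S φ) (hST : S ⊆ T) : entails T φ :=
  fun v w hT => h v w fun χ hχ => hT χ (hST hχ)

/-- The value of a formula when `L` is read as truth in all valuations of `P`. -/
noncomputable def epistemicEval (P : Set (ℕ → Bool)) : AE → (ℕ → Bool) → Bool
  | var n, v => v n
  | top, _ => true
  | bot, _ => false
  | neg φ, v => !(epistemicEval P φ v)
  | conj φ ψ, v => epistemicEval P φ v && epistemicEval P ψ v
  | disj φ ψ, v => epistemicEval P φ v || epistemicEval P ψ v
  | xor φ ψ, v => epistemicEval P φ v != epistemicEval P ψ v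
  | box φ, _ => @decide (∀ u ∈ P, epistemicEval P φ u = true) (Classical.propDecidable _)

theorem eval_epistemicEval (P : Set (ℕ → Bool)) (v : ℕ → Bool) (φ : AE) :
    eval v (fun χ => epistemicEval P (box χ) v) φ = epistemicEval P φ v := by
  induction φ <;> simp_all [eval, epistemicEval]

/-- If the truth of `S` does not depend on the modal atoms, and `S` entails `ψ`, then
`S ∪ {Lψ}` has a stable expansion. -/
theorem exists_isStableExpansion {S : Set AE} {ψ : AE}
    (hS : ∀ φ ∈ S, ∀ v w w', eval v w φ = eval v w' φ) (h : entails S ψ) :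
    ∃ Δ, IsStableExpansion (S ∪ {box ψ}) Δ := by
  let P : Set (ℕ → Bool) := {v | ∀ φ ∈ S, eval v (fun _ => true) φ = true}
  refine ⟨{φ | ∀ v ∈ P, epistemicEval P φ v = true}, ?_⟩
  have hP {v w} : v ∈ P ↔ ∀ φ ∈ S, eval v w φ = true :=
    forall₂_congr fun φ hφ => by rw [hS φ hφ v _ w]
  ext φ
  constructor
  · intro hφ v w hw
    have hw' : w = fun χ => epistemicEval P (box χ) v := by
      funext χ
      by_cases hχ : ∀ u ∈ P, epistemicEval P χ u = true
      · have := hw (box χ) (Or.inl (Or.inr ⟨χ, hχ, rfl⟩))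
        exact this.trans ((@decide_eq_true_iff _ (Classical.propDecidable _)).2 hχ).symm
      · have := hw (neg (box χ)) (Or.inr ⟨χ, hχ, rfl⟩)
        simpa [epistemicEval, eval, hχ] using this
    have hv : v ∈ P := hP.2 fun χ hχ => hw χ (Or.inl (Or.inl (Or.inl hχ)))
    rw [hw', eval_epistemicEval]
    exact hφ v hv
  · intro hφ v hv
    rw [← eval_epistemicEval]
    refine hφ v _ ?_
    rintro χ (((hχ | rfl) | ⟨χ, hχ, rfl⟩) | ⟨χ, hχ, rfl⟩)
    · exact hP.1 hv χ hχ
    · rw [eval_epistemicEval, epistemicEval]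
      refine (@decide_eq_true_iff _ (Classical.propDecidable _)).2 fun u hu => ?_
      rw [← eval_epistemicEval]
      exact h u _ (hP.1 hu)
    · simpa [eval, epistemicEval] using hχ
    · simpa [eval, epistemicEval] using hχ

/-- If the truth of `S` and of `ψ` does not depend on the modal atoms, and `S ∪ {Lψ}` has a stable
expansion, then `S` entails `ψ`. -/
theorem IsStableExpansion.entails {S Δ : Set AE} {ψ : AE}
    (hS : ∀ φ ∈ S, ∀ v w w', eval v w φ = eval v w' φ)
    (hψ : ∀ v w w', eval v w ψ = eval v w' ψ)
    (h : IsStableExpansion (S ∪ {box ψ}) Δ) : entails S ψ := by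
  classical
  have hmem : ψ ∈ Δ := by
    by_contra hn
    refine hn ?_
    rw [h]
    intro v w hw
    have hpos := hw (box ψ) (Or.inl (Or.inl (Or.inr rfl)))
    have hneg := hw (neg (box ψ)) (Or.inr ⟨ψ, hn, rfl⟩)
    simp_all [eval]
  have hent := hmem
  rw [h] at hent
  intro v w hw
  rw [hψ v w fun χ => decide (χ ∈ Δ)]
  refine hent v _ ?_
  rintro χ (((hχ | rfl) | ⟨χ, hχ, rfl⟩) | ⟨χ, hχ, rfl⟩)
  · rw [hS χ hχ v _ w]
    exact hw χ hχ
  · simpa [eval] using hmem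
  · simpa [eval] using hχ
  · simpa [eval] using hχ

/-- For propositional `Γ` and `ψ`, the set `{Lψ}` is `Γ ∪ {Lψ}`-full exactly if `Γ` entails `ψ`. -/
theorem entails_iff_isFull {Γ : Set AE} {ψ : AE}
    (hΓ : ∀ φ ∈ Γ, IsPropXorTop φ) (hψ : IsPropXorTop ψ) :
    entails Γ ψ ↔ IsFull (Γ ∪ {box ψ}) {box ψ} := by
  constructor
  · intro h
    have hent : entails (Γ ∪ {box ψ} ∪ {box ψ}) ψ := h.mono fun χ hχ => Or.inl (Or.inl hχ)
    refine ⟨?_, fun φ hφ => ?_⟩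
    · rintro _ rfl
      exact Or.inl ((box_mem_SFL_iff hΓ hψ ψ).2 rfl)
    · obtain rfl := (box_mem_SFL_iff hΓ hψ φ).1 hφ
      exact ⟨iff_of_true hent rfl, iff_of_false (not_not_intro hent) (by simp)⟩
  · rintro ⟨-, h⟩ v w hw
    have hent := (h ψ ((box_mem_SFL_iff hΓ hψ ψ).2 rfl)).1.2 rfl
    rw [hψ.eval_congr v w fun _ => true]
    refine hent v _ ?_
    rintro χ ((hχ | rfl) | rfl)
    · rw [(hΓ χ hχ).eval_congr v _ w]
      exact hw χ hχ
    · rfl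
    · rfl

/-- For purely propositional `Γ` and `ψ` built from `⊕` and `⊤`, and
`Σ = Γ ∪ {Lψ}`: `Γ ⊨ ψ` iff `{Lψ}` is `Σ`-full iff `Σ` has a stable
expansion. -/
theorem imp_reduces_to_exp (Γ : Set AE) (ψ : AE)
    (hΓ : ∀ φ ∈ Γ, IsPropXorTop φ) (hψ : IsPropXorTop ψ) :
    (entails Γ ψ ↔ IsFull (Γ ∪ {box ψ}) {box ψ}) ∧
    (IsFull (Γ ∪ {box ψ}) {box ψ} ↔ ∃ Δ : Set AE, IsStableExpansion (Γ ∪ {box ψ}) Δ) := by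
  refine ⟨entails_iff_isFull hΓ hψ, (entails_iff_isFull hΓ hψ).symm.trans ⟨?_, ?_⟩⟩
  · exact exists_isStableExpansion fun φ hφ => (hΓ φ hφ).eval_congr
  · rintro ⟨Δ, hΔ⟩
    exact hΔ.entails (fun φ hφ => (hΓ φ hφ).eval_congr) hψ.eval_congr

end AE
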